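/- Let A ∈ ℤ^{n×n} be nonsingular, U, M ∈ ℤ^{n×n}, T ∈ ℤ^{n×n} unit upper triangular, and S = diag(s_1, …, s_n) diagonal with positive diagonal entries satisfying the divisibility chain s_1 ∣ s_2 ∣ ⋯ ∣ s_n, such that the 2n×2n rational matrix B := [[A, 0],[0, I_n]] · [[I_n, 0],[U, I_n]] · [[I_n, M],[0, T]] · [[I_n, 0],[0, S^{-1}]] has all integer entries. Then B is unimodular (|det B| = 1) if and only if S is the Smith normal form of A, i.e., there exist unimodular U', V' ∈ ℤ^{n×n} with U'·A·V' = S. -/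

import Mathlib

open Matrix

/-- The `2n × 2n` massaged matrix
`B = [[A,0],[0,I]] * [[I,0],[U,I]] * [[I,M],[0,T]] * [[I,0],[0,S⁻¹]]` over `ℚ`. -/
noncomputable def massagedB (n : ℕ) (A U M T : Matrix (Fin n) (Fin n) ℤ)
    (s : Fin n → ℤ) : Matrix (Fin n ⊕ Fin n) (Fin n ⊕ Fin n) ℚ :=
  Matrix.fromBlocks (A.map ((↑) : ℤ → ℚ)) 0 0 1 *
  Matrix.fromBlocks 1 0 (U.map ((↑) : ℤ → ℚ)) 1 *
  Matrix.fromBlocks 1 (M.map ((↑) : ℤ → ℚ)) 0 (T.map ((↑) : ℤ → ℚ)) *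
  Matrix.fromBlocks 1 0 0 (Matrix.diagonal (fun i => (s i : ℚ)))⁻¹

section UnimodularCompletion

variable {ι κ : Type*} [Fintype ι] [DecidableEq ι] [Fintype κ] [DecidableEq κ]

theorem transvection_mulVec (i j : ι) (c : ℤ) (v : ι → ℤ) :
    transvection i j c *ᵥ v = v + Pi.single i (c * v j) := by
  rw [transvection, add_mulVec, one_mulVec, single_mulVec]
  rfl

/-- The Euclidean algorithm on an integer vector by transvections. -/
theorem exists_det_one_mulVec_eq_single (v : ι → ℤ) (i₀ : ι) :
    ∃ (G : Matrix ι ι ℤ) (i : ι) (g : ℤ), G.det = 1 ∧ G *ᵥ v = Pi.single i g := by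
  induction hk : ∑ i, (v i).natAbs using Nat.strong_induction_on generalizing v with
  | _ k ih =>
    by_cases h : ∃ i j, i ≠ j ∧ v i ≠ 0 ∧ v j ≠ 0
    · obtain ⟨i, j, hij, hj, hle⟩ :
          ∃ i j, i ≠ j ∧ v j ≠ 0 ∧ (v j).natAbs ≤ (v i).natAbs := by
        obtain ⟨i, j, hij, hi, hj⟩ := h
        rcases le_total (v j).natAbs (v i).natAbs with hle | hle
        · exact ⟨i, j, hij, hj, hle⟩
        · exact ⟨j, i, hij.symm, hi, hle⟩
      have hw : transvection i j (-(v i / v j)) *ᵥ v = Function.update v i (v i % v j) := by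
        ext l
        rw [transvection_mulVec]
        by_cases hl : l = i
        · subst hl
          simp [Int.emod_def]
          ring
        · simp [hl]
      have hlt : ∑ l, (Function.update v i (v i % v j) l).natAbs < k := by
        rw [← hk]
        refine Finset.sum_lt_sum (fun l _ => ?_) ⟨i, Finset.mem_univ i, ?_⟩
        · by_cases hl : l = i
          · subst hl
            have := Int.emod_nonneg (v l) hj
            have := Int.emod_lt_abs (v l) hj
            rw [Int.abs_eq_natAbs] at this
            simp only [Function.update_self]
            omega
          · simp [hl]
        · have := Int.emod_nonneg (v i) hj
          have := Int.emod_lt_abs (v i) hj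
          rw [Int.abs_eq_natAbs] at this
          simp only [Function.update_self]
          omega
      obtain ⟨G, l, g, hG, hGv⟩ := ih _ hlt _ rfl
      refine ⟨G * transvection i j (-(v i / v j)), l, g, ?_, ?_⟩
      · rw [det_mul, hG, det_transvection_of_ne _ _ hij, one_mul]
      · rw [← mulVec_mulVec, hw, hGv]
    · push Not at h
      by_cases h0 : ∃ i, v i ≠ 0
      · obtain ⟨i, hi⟩ := h0
        refine ⟨1, i, v i, det_one, ?_⟩
        ext l
        by_cases hl : l = i
        · subst hl; simp
        · simpa [hl] using h i l (Ne.symm hl) hi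
      · push Not at h0
        refine ⟨1, i₀, 0, det_one, ?_⟩
        ext l
        simp [h0 l]

/-- A vector that is primitive modulo `s` can be moved to any basis vector modulo `s`. -/
theorem exists_det_one_mulVec_eq_single_one_add [Nontrivial ι] (v u : ι → ℤ) (p s : ℤ)
    (h : u ⬝ᵥ v + p * s = 1) (i₀ : ι) :
    ∃ (G : Matrix ι ι ℤ) (x : ι → ℤ), G.det = 1 ∧ G *ᵥ v = Pi.single i₀ 1 + s • x := by
  obtain ⟨G, i, g, hG, hGv⟩ := exists_det_one_mulVec_eq_single v i₀
  have hinv : G⁻¹ * G = 1 := nonsing_inv_mul G (by simp [hG])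
  obtain ⟨c, hc⟩ : ∃ c, c * g + p * s = 1 := by
    refine ⟨(u ᵥ* G⁻¹) i, ?_⟩
    rw [← h, ← one_mulVec v, ← hinv, ← mulVec_mulVec, hGv, dotProduct_mulVec, dotProduct_single]
  by_cases hi : i = i₀
  · subst hi
    obtain ⟨j, hj⟩ := exists_ne i
    refine ⟨transvection j i (-1) * transvection i j (1 - g) * transvection j i c * G,
      Pi.single i (-(1 - g) * p) + Pi.single j (-p + (1 - g) * p), ?_, ?_⟩
    · simp [det_transvection_of_ne, hj, hj.symm, hG]
    · simp only [← mulVec_mulVec, hGv, transvection_mulVec]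
      ext l
      by_cases hl : l = i
      · subst hl
        simp [hj.symm]
        linear_combination (1 - g) * hc
      · by_cases hl' : l = j
        · subst hl'
          simp [hl, Ne.symm hl]
          linear_combination g * hc
        · simp [hl, hl']
  · refine ⟨transvection i i₀ (-g) * transvection i₀ i c * G, Pi.single i₀ (-p) +
      Pi.single i (g * p), ?_, ?_⟩
    · simp [det_transvection_of_ne, hi, Ne.symm hi, hG]
    · simp only [← mulVec_mulVec, hGv, transvection_mulVec]
      ext l
      by_cases hl : l = i
      · subst hl
        simp [Ne.symm hi]
        linear_combination (-g) * hc
      · by_cases hl' : l = i₀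
        · subst hl'
          simp [Ne.symm hi]
          linear_combination hc
        · simp [hl, hl']

/-- The stack of `M` on top of the diagonal matrix with entries `s` has a left inverse. -/
def LeftCoprimeDiagonal (M : Matrix ι ι ℤ) (s : ι → ℤ) : Prop :=
  ∃ U P : Matrix ι ι ℤ, U * M + P * diagonal s = 1

/-- After scaling columns, `M` is congruent to a matrix of determinant one, the `j`-th column
being taken modulo `s j`. -/
def LiftsToDetOne (M : Matrix ι ι ℤ) (s : ι → ℤ) : Prop :=
  ∃ (d : ι → ℤ) (N : Matrix ι ι ℤ), (M * diagonal d + N * diagonal s).det = 1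

theorem LeftCoprimeDiagonal.mul_add {M : Matrix ι ι ℤ} {s : ι → ℤ}
    (h : LeftCoprimeDiagonal M s) {G : Matrix ι ι ℤ} (hG : G.det = 1) (N : Matrix ι ι ℤ) :
    LeftCoprimeDiagonal (G * M + N * diagonal s) s := by
  obtain ⟨U, P, hUP⟩ := h
  have hinv : G⁻¹ * G = 1 := nonsing_inv_mul G (by simp [hG])
  refine ⟨U * G⁻¹, P - U * G⁻¹ * N, ?_⟩
  calc U * G⁻¹ * (G * M + N * diagonal s) + (P - U * G⁻¹ * N) * diagonal s
      = U * (G⁻¹ * G) * M + P * diagonal s := by noncomm_ring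
    _ = 1 := by rw [hinv, mul_one, hUP]

theorem LiftsToDetOne.of_mul_add {M G N : Matrix ι ι ℤ} {s : ι → ℤ} (hG : G.det = 1)
    (h : LiftsToDetOne (G * M + N * diagonal s) s) : LiftsToDetOne M s := by
  obtain ⟨d, K, hK⟩ := h
  have hinv : G * G⁻¹ = 1 := mul_nonsing_inv G (by simp [hG])
  refine ⟨d, G⁻¹ * (N * diagonal d + K), ?_⟩
  rw [← hK, ← one_mul (det _), ← hG, ← det_mul]
  congr 1
  have hcomm : diagonal s * diagonal d = diagonal d * diagonal s := by
    simp [diagonal_mul_diagonal, mul_comm]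
  calc G * (M * diagonal d + G⁻¹ * (N * diagonal d + K) * diagonal s)
      = G * M * diagonal d + (G * G⁻¹) * (N * (diagonal d * diagonal s) + K * diagonal s) := by
        noncomm_ring
    _ = (G * M + N * diagonal s) * diagonal d + K * diagonal s := by
        rw [hinv, ← hcomm]; noncomm_ring

theorem LeftCoprimeDiagonal.submatrix {M : Matrix ι ι ℤ} {s : ι → ℤ}
    (h : LeftCoprimeDiagonal M s) (e : κ ≃ ι) :
    LeftCoprimeDiagonal (M.submatrix e e) (s ∘ e) := by
  obtain ⟨U, P, hUP⟩ := h
  refine ⟨U.submatrix e e, P.submatrix e e, ?_⟩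
  rw [← submatrix_diagonal_equiv, submatrix_mul_equiv, submatrix_mul_equiv,
    ← submatrix_one_equiv e, ← hUP]
  rfl

theorem LiftsToDetOne.of_submatrix {M : Matrix ι ι ℤ} {s : ι → ℤ} (e : κ ≃ ι)
    (h : LiftsToDetOne (M.submatrix e e) (s ∘ e)) : LiftsToDetOne M s := by
  obtain ⟨d, N, hN⟩ := h
  refine ⟨d ∘ e.symm, N.submatrix e.symm e.symm, ?_⟩
  rw [← hN, ← det_submatrix_equiv_self e]
  congr 1
  ext i j
  simp [mul_diagonal]

/-- Peeling off a column that is already a basis vector modulo the largest modulus. -/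
theorem LeftCoprimeDiagonal.toBlocks₁₁ {M : Matrix ι ι ℤ} {r : Matrix Unit ι ℤ} {s : ι → ℤ}
    {t : ℤ} (hst : ∀ i, s i ∣ t)
    (h : LeftCoprimeDiagonal (fromBlocks M 0 r 1) (Sum.elim s fun _ : Unit => t)) :
    LeftCoprimeDiagonal M s := by
  obtain ⟨U, P, hUP⟩ := h
  choose k hk using hst
  have hS : diagonal (Sum.elim s fun _ : Unit => t) =
      fromBlocks (diagonal s) 0 0 (diagonal fun _ => t) := (fromBlocks_diagonal _ _).symm
  rw [← fromBlocks_toBlocks U, ← fromBlocks_toBlocks P, hS, fromBlocks_multiply,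
    fromBlocks_multiply, fromBlocks_add, ← fromBlocks_one, fromBlocks_inj] at hUP
  obtain ⟨h₁₁, h₁₂, -, -⟩ := hUP
  simp only [Matrix.mul_zero, zero_add, add_zero, Matrix.mul_one] at h₁₁ h₁₂
  have hr : (diagonal fun _ : Unit => t) * r = r * diagonal k * diagonal s := by
    ext i j
    simp only [diagonal_mul, mul_diagonal, hk j]
    ring
  refine ⟨U.toBlocks₁₁, P.toBlocks₁₁ - P.toBlocks₁₂ * (r * diagonal k), ?_⟩
  rw [← h₁₁, eq_neg_of_add_eq_zero_left h₁₂, Matrix.sub_mul, Matrix.mul_assoc P.toBlocks₁₂, ← hr,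
    Matrix.neg_mul, Matrix.mul_assoc]
  abel

theorem LiftsToDetOne.fromBlocks {M : Matrix ι ι ℤ} {r : Matrix Unit ι ℤ} {s : ι → ℤ} {t : ℤ}
    (h : LiftsToDetOne M s) :
    LiftsToDetOne (fromBlocks M 0 r 1) (Sum.elim s fun _ : Unit => t) := by
  obtain ⟨d, N, hN⟩ := h
  refine ⟨Sum.elim d fun _ => 1, Matrix.fromBlocks N 0 0 0, ?_⟩
  have hD (a : ι → ℤ) (b : Unit → ℤ) : diagonal (Sum.elim a b) =
      Matrix.fromBlocks (diagonal a) 0 0 (diagonal b) := (fromBlocks_diagonal _ _).symm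
  rw [hD, hD, fromBlocks_multiply, fromBlocks_multiply, fromBlocks_add]
  simp [hN]

theorem LeftCoprimeDiagonal.liftsToDetOne_sum [Nonempty ι] {s : ι → ℤ} {t : ℤ}
    (hst : ∀ i, s i ∣ t)
    (ih : ∀ M : Matrix ι ι ℤ, LeftCoprimeDiagonal M s → LiftsToDetOne M s)
    {M : Matrix (ι ⊕ Unit) (ι ⊕ Unit) ℤ}
    (h : LeftCoprimeDiagonal M (Sum.elim s fun _ => t)) :
    LiftsToDetOne M (Sum.elim s fun _ => t) := by
  obtain ⟨U, P, hUP⟩ := id h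
  have hlast := congrFun (congrFun hUP (Sum.inr ())) (Sum.inr ())
  rw [Matrix.add_apply, mul_diagonal, one_apply_eq, mul_apply] at hlast
  have : Nontrivial (ι ⊕ Unit) :=
    ⟨⟨Sum.inl (Classical.arbitrary ι), Sum.inr (), by simp⟩⟩
  obtain ⟨G, x, hG, hx⟩ := exists_det_one_mulVec_eq_single_one_add
    (fun i => M i (Sum.inr ())) (U (Sum.inr ())) _ t hlast (Sum.inr ())
  let N : Matrix (ι ⊕ Unit) (ι ⊕ Unit) ℤ := of fun i j => Sum.elim 0 (fun _ => -x i) j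
  have hcol : ∀ i, (G * M + N * diagonal (Sum.elim s fun _ => t) : Matrix _ _ ℤ) i (Sum.inr ()) =
      (Pi.single (Sum.inr ()) 1 : ι ⊕ Unit → ℤ) i := by
    intro i
    have hi : (G * M) i (Sum.inr ()) = _ := congrFun hx i
    rw [Matrix.add_apply, hi, mul_diagonal]
    simp [N]
    ring
  have hcop := h.mul_add hG N
  refine LiftsToDetOne.of_mul_add (N := N) hG ?_
  generalize G * M + N * diagonal (Sum.elim s fun _ => t) = K at hcol hcop
  have hK : K = Matrix.fromBlocks K.toBlocks₁₁ 0 K.toBlocks₂₁ 1 := by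
    conv_lhs => rw [← fromBlocks_toBlocks K]
    congr 1
    · ext i j
      simpa [toBlocks₁₂] using hcol (Sum.inl i)
    · ext i j
      simpa [toBlocks₂₂] using hcol (Sum.inr ())
  rw [hK] at hcop ⊢
  exact (ih _ (hcop.toBlocks₁₁ hst)).fromBlocks

end UnimodularCompletion

theorem LeftCoprimeDiagonal.liftsToDetOne {n : ℕ} {s : Fin n → ℤ}
    (hchain : ∀ i j : Fin n, i ≤ j → s i ∣ s j) {M : Matrix (Fin n) (Fin n) ℤ}
    (h : LeftCoprimeDiagonal M s) : LiftsToDetOne M s := by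
  induction n with
  | zero => exact ⟨0, 0, det_isEmpty⟩
  | succ n ih =>
    rcases n with _ | n
    · obtain ⟨U, P, hUP⟩ := h
      refine ⟨fun i => U i i, P, ?_⟩
      have h00 := congrFun (congrFun hUP 0) 0
      simp [mul_apply] at h00 ⊢
      linarith
    · let e : Fin (n + 1) ⊕ Unit ≃ Fin (n + 2) :=
        (Equiv.sumCongr (Equiv.refl _) (Equiv.ofUnique Unit (Fin 1))).trans finSumFinEquiv
      have he : s ∘ e = Sum.elim (fun i => s i.castSucc) fun _ => s (Fin.last _) := by
        ext (i | i)
        · rfl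
        · exact congrArg s (Fin.ext (by simp [e]))
      refine LiftsToDetOne.of_submatrix e ?_
      have hcop := h.submatrix e
      rw [he] at hcop ⊢
      refine hcop.liftsToDetOne_sum (fun i => hchain _ _ (Fin.le_last _)) fun M hM => ?_
      exact ih (fun i j hij => hchain _ _ (Fin.castSucc_le_castSucc_iff.2 hij)) hM

theorem massagedB_eq_fromBlocks (n : ℕ) (A U M T : Matrix (Fin n) (Fin n) ℤ) (s : Fin n → ℤ)
    (hs : ∀ i, s i ≠ 0) :
    massagedB n A U M T s = fromBlocks
      (A.map (↑)) ((A * M).map (↑) * diagonal fun i => (s i : ℚ)⁻¹)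
      (U.map (↑)) ((U * M + T).map (↑) * diagonal fun i => (s i : ℚ)⁻¹) := by
  have hinv : (diagonal fun i => (s i : ℚ))⁻¹ = diagonal fun i => (s i : ℚ)⁻¹ := by
    refine inv_eq_right_inv ?_
    simp [diagonal_mul_diagonal, hs]
  have hmul (X Y : Matrix (Fin n) (Fin n) ℤ) :
      (X * Y).map ((↑) : ℤ → ℚ) = X.map (↑) * Y.map (↑) := Matrix.map_mul_intCast X Y
  have hadd (X Y : Matrix (Fin n) (Fin n) ℤ) :
      (X + Y).map ((↑) : ℤ → ℚ) = X.map (↑) + Y.map (↑) := Matrix.map_add _ Int.cast_add X Y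
  rw [massagedB, hinv, hadd, hmul, hmul]
  simp [fromBlocks_multiply]

theorem det_massagedB (n : ℕ) (A U M T : Matrix (Fin n) (Fin n) ℤ) (s : Fin n → ℤ) :
    (massagedB n A U M T s).det = A.det * T.det * (∏ i, (s i : ℚ))⁻¹ := by
  have hdet (X : Matrix (Fin n) (Fin n) ℤ) : (X.map ((↑) : ℤ → ℚ)).det = X.det :=
    (Int.cast_det X).symm
  simp [massagedB, det_nonsing_inv, hdet]

/-- If `A` is nonsingular, the diagonal entries of `S` are positive and form a
divisibility chain, and the massaged matrix `B` is integral, then `B` is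
unimodular iff `S` is the Smith normal form of `A`. -/
theorem massagedB_unimodular_iff_smith (n : ℕ) (A U M T : Matrix (Fin n) (Fin n) ℤ)
    (hA : A.det ≠ 0)
    (hTut : ∀ i j : Fin n, j < i → T i j = 0)
    (hTdiag : ∀ i : Fin n, T i i = 1)
    (s : Fin n → ℤ) (hs : ∀ i, 0 < s i)
    (hchain : ∀ i j : Fin n, i ≤ j → s i ∣ s j)
    (hint : ∀ i j, ∃ z : ℤ, massagedB n A U M T s i j = (z : ℚ)) :
    |(massagedB n A U M T s).det| = 1 ↔
      ∃ U' V' : Matrix (Fin n) (Fin n) ℤ,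
        (U'.det = 1 ∨ U'.det = -1) ∧ (V'.det = 1 ∨ V'.det = -1) ∧
        U' * A * V' = Matrix.diagonal s := by
  have hT : T.det = 1 := by
    rw [det_of_isUpperTriangular fun i j hij => hTut i j hij]
    simp [hTdiag]
  have hpos : 0 < ∏ i, s i := Finset.prod_pos fun i _ => hs i
  have hdet : |(massagedB n A U M T s).det| = 1 ↔ |A.det| = ∏ i, s i := by
    have hposQ : (0 : ℚ) < ∏ i, (s i : ℚ) := by exact_mod_cast hpos
    rw [det_massagedB, hT, Int.cast_one, mul_one, abs_mul, abs_inv, abs_of_pos hposQ,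
      mul_inv_eq_one₀ hposQ.ne']
    exact_mod_cast Iff.rfl
  rw [hdet]
  constructor
  · intro hAs
    have hcol (X : Matrix (Fin n) (Fin n) ℤ)
        (hX : ∀ i j, ∃ z : ℤ, (X.map ((↑) : ℤ → ℚ) * diagonal fun i => (s i : ℚ)⁻¹) i j = z) :
        ∃ Q : Matrix (Fin n) (Fin n) ℤ, X = Q * diagonal s := by
      choose Q hQ using hX
      refine ⟨of Q, ?_⟩
      ext i j
      have h := hQ i j
      have hsj : (s j : ℚ) ≠ 0 := by exact_mod_cast (hs j).ne'
      rw [mul_diagonal, map_apply, ← div_eq_mul_inv, div_eq_iff hsj] at h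
      rw [mul_diagonal, of_apply]
      exact_mod_cast h
    rw [massagedB_eq_fromBlocks _ _ _ _ _ _ fun i => (hs i).ne'] at hint
    obtain ⟨Q, hQ⟩ := hcol (A * M) fun i j => hint (Sum.inl i) (Sum.inr j)
    obtain ⟨P, hP⟩ := hcol (U * M + T) fun i j => hint (Sum.inr i) (Sum.inr j)
    have hcop : LeftCoprimeDiagonal M s := by
      refine ⟨-(T⁻¹ * U), T⁻¹ * P, ?_⟩
      rw [Matrix.mul_assoc T⁻¹ P, ← hP, Matrix.mul_add, nonsing_inv_mul T (by simp [hT])]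
      noncomm_ring
    obtain ⟨d, N, hV⟩ := hcop.liftsToDetOne hchain
    set V := M * diagonal d + N * diagonal s with hVdef
    have hAV : A * V = (Q * diagonal d + A * N) * diagonal s := by
      have hcomm : diagonal s * diagonal d = diagonal d * diagonal s := by
        simp [diagonal_mul_diagonal, mul_comm]
      rw [hVdef, Matrix.mul_add, ← Matrix.mul_assoc, hQ, Matrix.mul_assoc Q, hcomm]
      noncomm_ring
    set W := Q * diagonal d + A * N
    have hW : W.det = 1 ∨ W.det = -1 := by
      have h := congrArg (fun X => |X.det|) hAV
      simp only [det_mul, hV, mul_one, det_diagonal, abs_mul, hAs, abs_of_pos hpos] at h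
      exact eq_or_eq_neg_of_abs_eq ((right_eq_mul₀ hpos.ne').1 h)
    have hWu : IsUnit W.det := Int.isUnit_iff.2 hW
    refine ⟨W⁻¹, V, ?_, Or.inl hV, ?_⟩
    · rw [← Int.isUnit_iff]
      exact isUnit_nonsing_inv_det W hWu
    · rw [Matrix.mul_assoc, hAV, ← Matrix.mul_assoc, nonsing_inv_mul W hWu, Matrix.one_mul]
  · rintro ⟨U', V', hU, hV, h⟩
    have h := congrArg (fun X => |X.det|) h
    simp only [det_mul, det_diagonal, abs_mul, abs_of_pos hpos] at h
    rwa [abs_eq zero_le_one |>.2 hU, abs_eq zero_le_one |>.2 hV, one_mul, mul_one] at h
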